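/- arXiv:2107.07827 — 2 statements merged into one kernel-verified Lean document; each statement's English description precedes it below -/
import Mathlib

section
/- Let f : ℤ → ℕ be finitely supported and k ≥ 1. Then the volume of the opening of f by a segment of length k satisfies V(γₖ f) = Σ_{h ≥ 1} Σ_{t ≥ k} t · n_{t,h}(f), where n_{t,h}(f) is the number of runs of the level set S_h(f) of cardinality t. -/
namespace Granulo

/-- Opening of a one-dimensional DEM `f` by a segment of length `k` (closed form):
`(γₖ f)(x) = max{ min{ f(y) : a ≤ y ≤ a+k−1 } : a ≤ x ≤ a+k−1 }`. -/
noncomputable def opening (k : ℕ) (f : ℤ → ℕ) (x : ℤ) : ℕ :=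
  sSup {m : ℕ | ∃ a : ℤ, a ≤ x ∧ x ≤ a + (k : ℤ) - 1 ∧
    m = sInf {n : ℕ | ∃ y : ℤ, a ≤ y ∧ y ≤ a + (k : ℤ) - 1 ∧ n = f y}}

/-- Volume of a one-dimensional DEM. -/
noncomputable def vol (f : ℤ → ℕ) : ℕ := ∑ᶠ x : ℤ, f x

/-- Level set `S_h(f) = {x : f x ≥ h}`. -/
def levelSet (h : ℕ) (f : ℤ → ℕ) : Set ℤ := {x : ℤ | h ≤ f x}

/-- A set of consecutive integers. -/
def IsInterval (R : Set ℤ) : Prop :=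
  ∀ a ∈ R, ∀ b ∈ R, ∀ c : ℤ, a ≤ c → c ≤ b → c ∈ R

/-- `R` is a run of `S`: a maximal nonempty set of consecutive integers contained in `S`. -/
def IsRun (S R : Set ℤ) : Prop :=
  R.Nonempty ∧ R ⊆ S ∧ IsInterval R ∧
    ∀ R' : Set ℤ, R ⊆ R' → R' ⊆ S → IsInterval R' → R' = R

/-- `n_{t,h}(f)`: number of runs of `S_h(f)` of cardinality `t`. -/
noncomputable def runCount (f : ℤ → ℕ) (t h : ℕ) : ℕ :=
  {R : Set ℤ | IsRun (levelSet h f) R ∧ R.ncard = t}.ncard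

/-- Granulometric probability `p_k(f) = (V(γₖ f) − V(γ_{k+1} f))/V(f)`. -/
noncomputable def p (k : ℕ) (f : ℤ → ℕ) : ℝ :=
  ((vol (opening k f) : ℝ) - (vol (opening (k+1) f) : ℝ)) / (vol f : ℝ)

/-- Granulometric index `GI(f) = −Σ_{k≥1} p_k log p_k` (terms with `p_k = 0` are `0`). -/
noncomputable def gi (f : ℤ → ℕ) : ℝ :=
  -∑ᶠ k ∈ Set.Ici (1 : ℕ), p k f * Real.log (p k f)

/-- Volume of a two-dimensional DEM. -/
noncomputable def vol2 (f : ℤ × ℤ → ℕ) : ℕ := ∑ᶠ q : ℤ × ℤ, f q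

/-- Horizontal opening: apply `γₖ` to each row `i ↦ f (i, ·)`. -/
noncomputable def hOpening (k : ℕ) (f : ℤ × ℤ → ℕ) : ℤ × ℤ → ℕ :=
  fun q => opening k (fun j => f (q.1, j)) q.2

/-- Row-wise run count `n_{t,h}^{(i)}(f)`. -/
noncomputable def rowRunCount (f : ℤ × ℤ → ℕ) (i : ℤ) (t h : ℕ) : ℕ :=
  runCount (fun j => f (i, j)) t h

/-- Granulometric probability w.r.t. horizontal openings. -/
noncomputable def p2 (k : ℕ) (f : ℤ × ℤ → ℕ) : ℝ :=
  ((vol2 (hOpening k f) : ℝ) - (vol2 (hOpening (k+1) f) : ℝ)) / (vol2 f : ℝ)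

/-- Granulometric index w.r.t. horizontal openings. -/
noncomputable def gi2 (f : ℤ × ℤ → ℕ) : ℝ :=
  -∑ᶠ k ∈ Set.Ici (1 : ℕ), p2 k f * Real.log (p2 k f)

theorem isInterval_iff_ordConnected {R : Set ℤ} : IsInterval R ↔ R.OrdConnected :=
  ⟨fun h => ⟨fun _ ha _ hb c hc => h _ ha _ hb c hc.1 hc.2⟩,
    fun h _ ha _ hb _ hac hcb => h.out ha hb ⟨hac, hcb⟩⟩

theorem IsRun.eq_ordConnectedComponent {S R : Set ℤ} (hR : IsRun S R) {x : ℤ} (hx : x ∈ R) :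
    S.ordConnectedComponent x = R := by
  obtain ⟨-, hRS, hRi, hmax⟩ := hR
  have := isInterval_iff_ordConnected.1 hRi
  exact hmax _ (Set.subset_ordConnectedComponent hx hRS) Set.ordConnectedComponent_subset
    (isInterval_iff_ordConnected.2 inferInstance)

theorem isRun_ordConnectedComponent {S : Set ℤ} {x : ℤ} (hx : x ∈ S) :
    IsRun S (S.ordConnectedComponent x) := by
  refine ⟨⟨x, Set.self_mem_ordConnectedComponent.2 hx⟩, Set.ordConnectedComponent_subset,
    isInterval_iff_ordConnected.2 inferInstance, fun R' hR hS hi => ?_⟩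
  have := isInterval_iff_ordConnected.1 hi
  exact (Set.subset_ordConnectedComponent
    (hR (Set.self_mem_ordConnectedComponent.2 hx)) hS).antisymm hR

/-- A point of a finite set lies in a segment of length `k` inside the set iff its
connected component has at least `k` elements. -/
theorem exists_Icc_subset_iff {S : Set ℤ} (hS : S.Finite) {k : ℕ} (hk : 1 ≤ k) {x : ℤ} :
    (∃ a : ℤ, a ≤ x ∧ x ≤ a + (k : ℤ) - 1 ∧ Set.Icc a (a + k - 1) ⊆ S) ↔
      x ∈ S ∧ k ≤ (S.ordConnectedComponent x).ncard := by
  constructor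
  · rintro ⟨a, hax, hxa, ha⟩
    refine ⟨ha ⟨hax, hxa⟩, ?_⟩
    have hsub : Set.Icc a (a + k - 1) ⊆ S.ordConnectedComponent x :=
      Set.subset_ordConnectedComponent ⟨hax, hxa⟩ ha
    have hle := Set.ncard_le_ncard hsub (hS.subset Set.ordConnectedComponent_subset)
    rw [← Finset.coe_Icc, Set.ncard_coe_finset, Int.card_Icc] at hle
    omega
  · rintro ⟨hx, hcard⟩
    set C := S.ordConnectedComponent x
    have hCfin : C.Finite := hS.subset Set.ordConnectedComponent_subset
    have hxC : x ∈ C := Set.self_mem_ordConnectedComponent.2 hx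
    obtain ⟨m, hmC, hm⟩ := Set.exists_min_image C id hCfin ⟨x, hxC⟩
    obtain ⟨M, hMC, hM⟩ := Set.exists_max_image C id hCfin ⟨x, hxC⟩
    have hsub : C ⊆ (Finset.Icc m M : Finset ℤ) := fun y hy => by
      simpa using ⟨hm y hy, hM y hy⟩
    have hle := Set.ncard_le_ncard hsub (Finset.finite_toSet _)
    rw [Set.ncard_coe_finset, Int.card_Icc] at hle
    have hmx : m ≤ x := hm x hxC
    have hxM : x ≤ M := hM x hxC
    have hCord : C.OrdConnected := inferInstance
    refine ⟨min x (M - k + 1), by omega, by omega, fun y hy => ?_⟩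
    exact Set.ordConnectedComponent_subset
      (hCord.out hmC hMC ⟨by have := hy.1; omega, by have := hy.2; omega⟩)

theorem le_opening_iff {f : ℤ → ℕ} {k h : ℕ} (hk : 1 ≤ k) {x : ℤ} :
    h ≤ opening k f x ↔
      ∃ a : ℤ, a ≤ x ∧ x ≤ a + (k : ℤ) - 1 ∧ Set.Icc a (a + k - 1) ⊆ levelSet h f := by
  unfold opening
  set T := {m : ℕ | ∃ a : ℤ, a ≤ x ∧ x ≤ a + (k : ℤ) - 1 ∧
    m = sInf {n : ℕ | ∃ y : ℤ, a ≤ y ∧ y ≤ a + (k : ℤ) - 1 ∧ n = f y}}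
  have hbdd : BddAbove T := ⟨f x, by
    rintro m ⟨a, hax, hxa, rfl⟩
    exact Nat.sInf_le ⟨x, hax, hxa, rfl⟩⟩
  have hne : T.Nonempty := ⟨_, x, le_rfl, by omega, rfl⟩
  constructor
  · intro hle
    obtain ⟨a, hax, hxa, ha⟩ := Nat.sSup_mem hne hbdd
    refine ⟨a, hax, hxa, fun y hy => ?_⟩
    exact (hle.trans_eq ha).trans (Nat.sInf_le ⟨y, hy.1, hy.2, rfl⟩)
  · rintro ⟨a, hax, hxa, ha⟩
    refine le_trans ?_ (le_csSup hbdd ⟨a, hax, hxa, rfl⟩)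
    refine le_csInf ⟨_, x, hax, hxa, rfl⟩ ?_
    rintro _ ⟨y, hay, hya, rfl⟩
    exact ha ⟨hay, hya⟩

theorem levelSet_finite {f : ℤ → ℕ} (hf : (Function.support f).Finite) {h : ℕ} (hh : 1 ≤ h) :
    (levelSet h f).Finite :=
  hf.subset fun x (hx : h ≤ f x) => by
    rw [Function.mem_support]
    omega

/-- Layer-cake formula for the volume. -/
theorem vol_eq_finsum_ncard_levelSet {g : ℤ → ℕ} (hg : (Function.support g).Finite) :
    vol g = ∑ᶠ h ∈ Set.Ici (1 : ℕ), (levelSet h g).ncard := by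
  set s := hg.toFinset
  set M := s.sup g
  have hM : ∀ x ∈ s, g x ≤ M := fun x hx => Finset.le_sup (f := g) hx
  have hcard : ∀ h ∈ Set.Ici (1 : ℕ),
      (levelSet h g).ncard = ∑ x ∈ s, if h ≤ g x then 1 else 0 := by
    intro h hh
    rw [← Finset.card_filter, ← Set.ncard_coe_finset]
    congr 1
    ext x
    have : 1 ≤ h := hh
    simp only [levelSet, Set.mem_ofPred_eq, Finset.coe_filter, s, Set.Finite.mem_toFinset,
      Function.mem_support]
    omega
  have hlayer : ∀ x ∈ s, g x = ∑ h ∈ Finset.Icc 1 M, if h ≤ g x then 1 else 0 := by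
    intro x hx
    have : (Finset.Icc 1 M).filter (· ≤ g x) = Finset.Icc 1 (g x) := by
      ext h
      have := hM x hx
      simp only [Finset.mem_filter, Finset.mem_Icc]
      omega
    rw [← Finset.card_filter, this, Nat.card_Icc, Nat.add_sub_cancel]
  rw [finsum_mem_congr rfl hcard, vol, finsum_eq_sum_of_support_subset g (s := s) (by simp [s]),
    Finset.sum_congr rfl hlayer, Finset.sum_comm]
  refine (finsum_mem_eq_sum_of_inter_support_eq _ ?_).symm
  ext h
  simp only [Set.mem_inter_iff, Set.mem_Ici, Function.mem_support, Finset.coe_Icc, Set.mem_Icc,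
    and_congr_left_iff]
  intro hne
  obtain ⟨x, hx, hxne⟩ := Finset.exists_ne_zero_of_sum_ne_zero hne
  have hle : h ≤ g x := by by_contra hcon; simp [hcon] at hxne
  have := hM x hx
  omega

/-- Points whose component has `t` elements, counted run by run. -/
theorem ncard_component_eq {S : Set ℤ} (hS : S.Finite) (t : ℕ) :
    {x ∈ S | (S.ordConnectedComponent x).ncard = t}.ncard =
      t * {R : Set ℤ | IsRun S R ∧ R.ncard = t}.ncard := by
  classical
  set A := hS.toFinset.filter fun x => (S.ordConnectedComponent x).ncard = t with hA
  have hmem : ∀ x, x ∈ A ↔ x ∈ S ∧ (S.ordConnectedComponent x).ncard = t := by simp [hA]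
  have hruns : {R : Set ℤ | IsRun S R ∧ R.ncard = t} = A.image S.ordConnectedComponent := by
    ext R
    simp only [Set.mem_ofPred_eq, Finset.coe_image, Set.mem_image, Finset.mem_coe, hmem]
    constructor
    · rintro ⟨hR, rfl⟩
      obtain ⟨x, hx⟩ := hR.1
      have := hR.eq_ordConnectedComponent hx
      exact ⟨x, ⟨hR.2.1 hx, by rw [this]⟩, this⟩
    · rintro ⟨x, ⟨hx, ht⟩, rfl⟩
      exact ⟨isRun_ordConnectedComponent hx, ht⟩
  have hset : {x ∈ S | (S.ordConnectedComponent x).ncard = t} = A := by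
    ext x
    simp [hmem]
  rw [hruns, hset, Set.ncard_coe_finset, Set.ncard_coe_finset,
    Finset.card_eq_sum_card_image S.ordConnectedComponent A, mul_comm, ← smul_eq_mul]
  refine Finset.sum_const_nat ?_
  intro R hR
  have hR' : IsRun S R ∧ R.ncard = t := by
    have : R ∈ {R : Set ℤ | IsRun S R ∧ R.ncard = t} := by rw [hruns]; exact hR
    exact this
  obtain ⟨hrun, rfl⟩ := hR'
  rw [← Set.ncard_coe_finset]
  congr 1
  ext x
  simp only [Finset.coe_filter, hmem, Set.mem_ofPred_eq]
  constructor
  · rintro ⟨⟨hx, -⟩, rfl⟩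
    exact Set.self_mem_ordConnectedComponent.2 hx
  · intro hx
    have := hrun.eq_ordConnectedComponent hx
    exact ⟨⟨hrun.2.1 hx, by rw [this]⟩, this⟩

theorem ncard_le_component_eq_finsum {S : Set ℤ} (hS : S.Finite) (k : ℕ) :
    {x ∈ S | k ≤ (S.ordConnectedComponent x).ncard}.ncard =
      ∑ᶠ t ∈ Set.Ici k, t * {R : Set ℤ | IsRun S R ∧ R.ncard = t}.ncard := by
  classical
  have hle : ∀ x, (S.ordConnectedComponent x).ncard ≤ S.ncard := fun x =>
    Set.ncard_le_ncard Set.ordConnectedComponent_subset hS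
  simp only [← ncard_component_eq hS]
  set A := hS.toFinset.filter fun x => k ≤ (S.ordConnectedComponent x).ncard with hA
  have hset : {x ∈ S | k ≤ (S.ordConnectedComponent x).ncard} = A := by
    ext x
    simp [hA]
  rw [finsum_mem_eq_sum_of_inter_support_eq (t := Finset.Icc k S.ncard), hset,
    Set.ncard_coe_finset, Finset.card_eq_sum_card_fiberwise
      (f := fun x => (S.ordConnectedComponent x).ncard) (t := Finset.Icc k S.ncard)]
  · refine Finset.sum_congr rfl fun t ht => ?_
    rw [← Set.ncard_coe_finset]
    congr 1
    ext x
    have := (Finset.mem_Icc.1 ht).1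
    simp only [hA, Finset.coe_filter, Finset.mem_filter, Set.Finite.mem_toFinset,
      Set.mem_ofPred_eq]
    grind
  · intro x hx
    simp only [hA, Finset.coe_filter, Set.mem_ofPred_eq] at hx
    simpa using ⟨hx.2, hle x⟩
  · ext t
    simp only [Set.mem_inter_iff, Set.mem_Ici, Function.mem_support, Finset.coe_Icc, Set.mem_Icc,
      and_congr_left_iff]
    intro hne
    obtain ⟨x, -, rfl⟩ := Set.nonempty_of_ncard_ne_zero hne
    simp [hle x]

/-- `V(γₖ f) = Σ_{h ≥ 1} Σ_{t ≥ k} t · n_{t,h}(f)`. -/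
theorem vol_opening_eq_sum_runs (f : ℤ → ℕ)
    (hf : (Function.support f).Finite) (k : ℕ) (hk : 1 ≤ k) :
    vol (opening k f) =
      ∑ᶠ h ∈ Set.Ici (1 : ℕ), ∑ᶠ t ∈ Set.Ici k, t * runCount f t h := by
  have hlevel : ∀ h, 1 ≤ h → levelSet h (opening k f) = {x ∈ levelSet h f |
      k ≤ ((levelSet h f).ordConnectedComponent x).ncard} := fun h hh => by
    ext x
    exact (le_opening_iff hk).trans (exists_Icc_subset_iff (levelSet_finite hf hh) hk)
  have hsupp : (Function.support (opening k f)).Finite := by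
    refine (levelSet_finite hf le_rfl).subset fun x hx => ?_
    have hx1 : x ∈ levelSet 1 (opening k f) := Nat.one_le_iff_ne_zero.2 hx
    rw [hlevel 1 le_rfl] at hx1
    exact hx1.1
  rw [vol_eq_finsum_ncard_levelSet hsupp]
  refine finsum_mem_congr rfl fun h hh => ?_
  rw [hlevel h hh, ncard_le_component_eq_finsum (levelSet_finite hf hh)]
  rfl

end Granulo
end

section
/- Let f : ℤ² → ℕ be finitely supported and let the horizontal opening Γₖ f be defined by applying the one-dimensional opening γₖ to each row i ↦ f(i, ·). Then for every k ≥ 1, V(Γₖ f) − V(Γ_{k+1} f) = Σ_i k · Σ_{h ≥ 1} n_{k,h}^{(i)}(f), where n_{t,h}^{(i)}(f) is the number of runs of cardinality t of the level set {j ∈ ℤ : f(i,j) ≥ h} of row i. -/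
namespace Granulo

/-- Opening of the set `S` by a segment of length `k`: the union of the translates of the segment
that are contained in `S`. -/
def setOpening (k : ℕ) (S : Set ℤ) : Set ℤ :=
  {x | ∃ a : ℤ, x ∈ Set.Icc a (a + k - 1) ∧ Set.Icc a (a + k - 1) ⊆ S}

/-- Left endpoints of the runs of `S` of cardinality `k`. -/
def runStarts (k : ℕ) (S : Set ℤ) : Set ℤ :=
  {a | Set.Icc a (a + k - 1) ⊆ S ∧ a - 1 ∉ S ∧ a + k ∉ S}

theorem setOpening_subset (k : ℕ) (S : Set ℤ) : setOpening k S ⊆ S :=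
  fun _ ⟨_, hx, hS⟩ => hS hx

theorem setOpening_succ_subset {k : ℕ} (hk : 1 ≤ k) (S : Set ℤ) :
    setOpening (k + 1) S ⊆ setOpening k S := by
  rintro x ⟨a, ⟨hax, hxa⟩, hS⟩
  push_cast at hxa hS
  by_cases h : x ≤ a + k - 1
  · exact ⟨a, ⟨hax, h⟩, fun y hy => hS ⟨hy.1, by linarith [hy.2]⟩⟩
  · exact ⟨a + 1, ⟨by omega, by omega⟩, fun y hy => hS ⟨by linarith [hy.1], by linarith [hy.2]⟩⟩

theorem runStarts_subset {k : ℕ} (hk : 1 ≤ k) (S : Set ℤ) : runStarts k S ⊆ S :=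
  fun _ ha => ha.1 ⟨le_rfl, by omega⟩

theorem setOpening_diff_succ (k : ℕ) (S : Set ℤ) :
    setOpening k S \ setOpening (k + 1) S = ⋃ a ∈ runStarts k S, Set.Icc a (a + k - 1) := by
  ext x
  simp only [Set.mem_sdiff, Set.mem_iUnion, exists_prop]
  constructor
  · rintro ⟨⟨a, hx, hS⟩, hn⟩
    refine ⟨a, ⟨hS, fun h => hn ?_, fun h => hn ?_⟩, hx⟩
    · refine ⟨a - 1, ⟨by linarith [hx.1], by push_cast; linarith [hx.2]⟩, fun y hy => ?_⟩
      obtain ⟨hy₁, hy₂⟩ := hy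
      push_cast at hy₂
      rcases eq_or_lt_of_le hy₁ with rfl | hlt
      · exact h
      · exact hS ⟨by omega, by omega⟩
    · refine ⟨a, ⟨hx.1, by push_cast; linarith [hx.2]⟩, fun y hy => ?_⟩
      obtain ⟨hy₁, hy₂⟩ := hy
      push_cast at hy₂
      by_cases hy : y = a + k
      · exact hy ▸ h
      · exact hS ⟨hy₁, by omega⟩
  · rintro ⟨a, ⟨hS, hl, hr⟩, hx⟩
    refine ⟨⟨a, hx, hS⟩, ?_⟩
    rintro ⟨b, ⟨hb₁, hb₂⟩, hbS⟩
    obtain ⟨ha₁, ha₂⟩ := hx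
    push_cast at hb₂ hbS
    by_cases hab : a ≤ b
    · exact hr (hbS ⟨by omega, by omega⟩)
    · exact hl (hbS ⟨by omega, by omega⟩)

theorem pairwiseDisjoint_runStarts (k : ℕ) (S : Set ℤ) :
    (runStarts k S).PairwiseDisjoint fun a => Set.Icc a (a + k - 1) := by
  have key : ∀ a ∈ runStarts k S, ∀ b ∈ runStarts k S, a < b →
      Disjoint (Set.Icc a (a + k - 1)) (Set.Icc b (b + k - 1)) := by
    intro a ha b hb hab
    rw [Set.disjoint_left]
    rintro x ⟨h₁, h₂⟩ ⟨h₃, h₄⟩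
    exact hb.2.1 (ha.1 ⟨by omega, by omega⟩)
  intro a ha b hb hab
  rcases lt_or_gt_of_ne hab with h | h
  · exact key a ha b hb h
  · exact (key b hb a ha h).symm

theorem ncard_Icc_int (a : ℤ) (k : ℕ) : (Set.Icc a (a + k - 1)).ncard = k := by
  rw [← Finset.coe_Icc, Set.ncard_coe_finset, Int.card_Icc]
  omega

theorem ncard_setOpening {k : ℕ} (hk : 1 ≤ k) {S : Set ℤ} (hS : S.Finite) :
    (setOpening k S).ncard = (setOpening (k + 1) S).ncard + k * (runStarts k S).ncard := by
  have hA := hS.subset (runStarts_subset hk S)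
  have hU : (⋃ a ∈ runStarts k S, Set.Icc a (a + (k : ℤ) - 1)).ncard
      = k * (runStarts k S).ncard := by
    have hdisj := pairwiseDisjoint_runStarts k S
    rw [← hA.coe_toFinset] at hdisj
    have hcoe : (⋃ a ∈ runStarts k S, Set.Icc a (a + (k : ℤ) - 1))
        = (hA.toFinset.biUnion fun a => Finset.Icc a (a + (k : ℤ) - 1) : Finset ℤ) := by
      simp
    rw [hcoe, Set.ncard_coe_finset, Finset.card_biUnion, Set.ncard_eq_toFinset_card _ hA]
    · simp [mul_comm]
    · intro a ha b hb hab
      simpa [← Finset.disjoint_coe] using hdisj ha hb hab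
  rw [← hU, ← setOpening_diff_succ, add_comm,
    Set.ncard_sdiff_add_ncard_of_subset (setOpening_succ_subset hk S)
      (hS.subset (setOpening_subset k S))]

theorem IsInterval.exists_eq_Icc {R : Set ℤ} (hI : IsInterval R) (hne : R.Nonempty)
    (hfin : R.Finite) : ∃ a b : ℤ, a ≤ b ∧ R = Set.Icc a b := by
  have hne' : hfin.toFinset.Nonempty := by simpa using hne
  have hmin := hfin.mem_toFinset.1 (hfin.toFinset.min'_mem hne')
  have hmax := hfin.mem_toFinset.1 (hfin.toFinset.max'_mem hne')
  refine ⟨_, _, Finset.min'_le _ _ (hfin.toFinset.max'_mem hne'), Set.Subset.antisymm ?_ ?_⟩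
  · exact fun x hx => ⟨Finset.min'_le _ _ (hfin.mem_toFinset.2 hx),
      Finset.le_max' _ _ (hfin.mem_toFinset.2 hx)⟩
  · exact fun x hx => hI _ hmin _ hmax x hx.1 hx.2

theorem isInterval_Icc (a b : ℤ) : IsInterval (Set.Icc a b) :=
  fun _ hx _ hy _ h₁ h₂ => ⟨hx.1.trans h₁, h₂.trans hy.2⟩

theorem isRun_Icc {k : ℕ} (hk : 1 ≤ k) {S : Set ℤ} {a : ℤ} (ha : a ∈ runStarts k S) :
    IsRun S (Set.Icc a (a + k - 1)) := by
  obtain ⟨hS, hl, hr⟩ := ha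
  refine ⟨⟨a, le_rfl, by omega⟩, hS, isInterval_Icc _ _, fun R' hR hR' hI => ?_⟩
  have haR : a ∈ R' := hR ⟨le_rfl, by omega⟩
  refine Set.Subset.antisymm (fun x hx => ⟨?_, ?_⟩) hR
  · by_contra! h
    exact hl (hR' (hI x hx a haR (a - 1) (by omega) (by omega)))
  · by_contra! h
    exact hr (hR' (hI a haR x hx (a + k) (by omega) (by omega)))

theorem IsRun.left_notMem {S : Set ℤ} {a b : ℤ} (hab : a ≤ b) (h : IsRun S (Set.Icc a b)) :
    a - 1 ∉ S := by
  intro hS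
  have heq := h.2.2.2 (Set.Icc (a - 1) b) (Set.Icc_subset_Icc_left (by omega)) (fun y hy => ?_)
    (isInterval_Icc _ _)
  · have : a - 1 ∈ Set.Icc a b := heq ▸ ⟨le_rfl, by omega⟩
    exact absurd this.1 (by omega)
  · rcases eq_or_lt_of_le hy.1 with rfl | hlt
    · exact hS
    · exact h.2.1 ⟨by omega, hy.2⟩

theorem IsRun.right_notMem {S : Set ℤ} {a b : ℤ} (hab : a ≤ b) (h : IsRun S (Set.Icc a b)) :
    b + 1 ∉ S := by
  intro hS
  have heq := h.2.2.2 (Set.Icc a (b + 1)) (Set.Icc_subset_Icc_right (by omega)) (fun y hy => ?_)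
    (isInterval_Icc _ _)
  · have : b + 1 ∈ Set.Icc a b := heq ▸ ⟨by omega, le_rfl⟩
    exact absurd this.2 (by omega)
  · rcases eq_or_lt_of_le hy.2 with rfl | hlt
    · exact hS
    · exact h.2.1 ⟨hy.1, by omega⟩

theorem setOf_isRun_ncard_eq {k : ℕ} (hk : 1 ≤ k) (S : Set ℤ) :
    {R : Set ℤ | IsRun S R ∧ R.ncard = k}
      = (fun a : ℤ => Set.Icc a (a + k - 1)) '' runStarts k S := by
  ext R
  constructor
  · rintro ⟨hrun, hcard⟩
    obtain ⟨a, b, hab, rfl⟩ := hrun.2.2.1.exists_eq_Icc hrun.1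
      (Set.finite_of_ncard_pos (by omega))
    have hb : b = a + k - 1 := by
      rw [← Finset.coe_Icc, Set.ncard_coe_finset, Int.card_Icc] at hcard
      omega
    subst hb
    have hr := hrun.right_notMem hab
    rw [sub_add_cancel] at hr
    exact ⟨a, ⟨hrun.2.1, hrun.left_notMem hab, hr⟩, rfl⟩
  · rintro ⟨a, ha, rfl⟩
    exact ⟨isRun_Icc hk ha, ncard_Icc_int a k⟩

theorem runCount_eq_ncard_runStarts {k : ℕ} (hk : 1 ≤ k) (g : ℤ → ℕ) (h : ℕ) :
    runCount g k h = (runStarts k (levelSet h g)).ncard := by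
  rw [runCount, setOf_isRun_ncard_eq hk, Set.ncard_image_of_injective]
  intro a b hab
  have ha : a ∈ Set.Icc b (b + k - 1) := hab.subset ⟨le_rfl, by omega⟩
  have hb : b ∈ Set.Icc a (a + k - 1) := hab.superset ⟨le_rfl, by omega⟩
  exact le_antisymm hb.1 ha.1

theorem levelSet_opening {k : ℕ} (hk : 1 ≤ k) (g : ℤ → ℕ) (h : ℕ) :
    levelSet h (opening k g) = setOpening k (levelSet h g) := by
  have hle : ∀ a : ℤ, h ≤ sInf {n : ℕ | ∃ y : ℤ, a ≤ y ∧ y ≤ a + (k : ℤ) - 1 ∧ n = g y} ↔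
      Set.Icc a (a + k - 1) ⊆ levelSet h g := by
    intro a
    have hne : {n : ℕ | ∃ y : ℤ, a ≤ y ∧ y ≤ a + (k : ℤ) - 1 ∧ n = g y}.Nonempty :=
      ⟨g a, a, le_rfl, by omega, rfl⟩
    rw [le_csInf_iff (OrderBot.bddBelow _) hne]
    constructor
    · exact fun H y hy => H _ ⟨y, hy.1, hy.2, rfl⟩
    · rintro H _ ⟨y, h₁, h₂, rfl⟩
      exact H ⟨h₁, h₂⟩
  ext x
  have hbdd : BddAbove {m : ℕ | ∃ a : ℤ, a ≤ x ∧ x ≤ a + (k : ℤ) - 1 ∧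
      m = sInf {n : ℕ | ∃ y : ℤ, a ≤ y ∧ y ≤ a + (k : ℤ) - 1 ∧ n = g y}} := by
    refine ⟨g x, ?_⟩
    rintro _ ⟨a, h₁, h₂, rfl⟩
    exact Nat.sInf_le ⟨x, h₁, h₂, rfl⟩
  have hne : {m : ℕ | ∃ a : ℤ, a ≤ x ∧ x ≤ a + (k : ℤ) - 1 ∧
      m = sInf {n : ℕ | ∃ y : ℤ, a ≤ y ∧ y ≤ a + (k : ℤ) - 1 ∧ n = g y}}.Nonempty :=
    ⟨_, x, le_rfl, by omega, rfl⟩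
  constructor
  · intro hx
    obtain ⟨a, h₁, h₂, h₃⟩ := Nat.sSup_mem hne hbdd
    exact ⟨a, ⟨h₁, h₂⟩, (hle a).1 (h₃ ▸ hx)⟩
  · rintro ⟨a, ⟨h₁, h₂⟩, hS⟩
    exact ((hle a).2 hS).trans (le_csSup hbdd ⟨a, h₁, h₂, rfl⟩)

theorem opening_le {k : ℕ} (hk : 1 ≤ k) (g : ℤ → ℕ) (x : ℤ) : opening k g x ≤ g x := by
  have hx : x ∈ levelSet (opening k g x) (opening k g) := le_refl (opening k g x)
  rw [levelSet_opening hk] at hx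
  exact setOpening_subset k _ hx

theorem finite_levelSet {g : ℤ → ℕ} (hg : (Function.support g).Finite) {h : ℕ} (hh : 1 ≤ h) :
    (levelSet h g).Finite :=
  hg.subset fun x hx => by
    have : h ≤ g x := hx
    rw [Function.mem_support]
    omega

/-- The volume of a one-dimensional DEM is the sum of the cardinalities of its level sets. -/
theorem vol_eq_sum_ncard_levelSet {g : ℤ → ℕ} (hg : (Function.support g).Finite) {M : ℕ}
    (hM : ∀ x, g x ≤ M) : vol g = ∑ h ∈ Finset.Icc 1 M, (levelSet h g).ncard := by
  have hrow : ∀ x ∈ hg.toFinset, g x = ∑ h ∈ Finset.Icc 1 M, if h ≤ g x then 1 else 0 := by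
    intro x _
    rw [← Finset.card_filter]
    have : (Finset.Icc 1 M).filter (· ≤ g x) = Finset.Icc 1 (g x) := by
      ext h
      have := hM x
      simp only [Finset.mem_filter, Finset.mem_Icc]
      omega
    simp [this]
  rw [vol, finsum_eq_sum _ hg, Finset.sum_congr rfl hrow, Finset.sum_comm]
  refine Finset.sum_congr rfl fun h hh => ?_
  rw [← Finset.card_filter, ← Set.ncard_coe_finset]
  congr 1
  ext x
  have := (Finset.mem_Icc.1 hh).1
  simp only [Finset.coe_filter, Set.Finite.mem_toFinset, Function.mem_support, Set.mem_ofPred_eq,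
    levelSet]
  omega

theorem vol_opening_eq {g : ℤ → ℕ} (hg : (Function.support g).Finite) {k : ℕ} (hk : 1 ≤ k) :
    vol (opening k g) =
      vol (opening (k + 1) g) + k * ∑ᶠ h ∈ Set.Ici (1 : ℕ), runCount g k h := by
  obtain ⟨M, hM⟩ : ∃ M, ∀ x, g x ≤ M := by
    refine ⟨hg.toFinset.sup g, fun x => ?_⟩
    by_cases hx : g x = 0
    · simp [hx]
    · exact Finset.le_sup (f := g) (hg.mem_toFinset.2 hx)
  have hvol : ∀ m : ℕ, 1 ≤ m → vol (opening m g) =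
      ∑ h ∈ Finset.Icc 1 M, (setOpening m (levelSet h g)).ncard := by
    intro m hm
    rw [vol_eq_sum_ncard_levelSet (hg.subset fun x hx => ?_)
      fun x => (opening_le hm g x).trans (hM x)]
    · simp_rw [levelSet_opening hm]
    · have := opening_le hm g x
      rw [Function.mem_support] at hx ⊢
      omega
  have hrun : ∑ᶠ h ∈ Set.Ici (1 : ℕ), runCount g k h
      = ∑ h ∈ Finset.Icc 1 M, (runStarts k (levelSet h g)).ncard := by
    simp_rw [runCount_eq_ncard_runStarts hk]
    refine finsum_mem_eq_sum_of_inter_support_eq _ ?_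
    ext h
    simp only [Set.mem_inter_iff, Set.mem_Ici, Function.mem_support, Finset.coe_Icc, Set.mem_Icc,
      and_congr_left_iff]
    refine fun hne => ⟨fun h₁ => ⟨h₁, ?_⟩, fun h₁ => h₁.1⟩
    obtain ⟨x, hx⟩ := Set.nonempty_of_ncard_ne_zero hne
    exact (show h ≤ g x from runStarts_subset hk _ hx).trans (hM x)
  rw [hvol k hk, hvol (k + 1) (by omega), hrun, Finset.mul_sum, ← Finset.sum_add_distrib]
  exact Finset.sum_congr rfl fun h hh =>
    ncard_setOpening hk (finite_levelSet hg (Finset.mem_Icc.1 hh).1)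

theorem finite_support_row {f : ℤ × ℤ → ℕ} (hf : (Function.support f).Finite) (i : ℤ) :
    (Function.support fun j => f (i, j)).Finite :=
  hf.preimage (f := fun j => (i, j)) (Prod.mk_right_injective i).injOn

theorem support_hOpening_subset {k : ℕ} (hk : 1 ≤ k) (f : ℤ × ℤ → ℕ) :
    Function.support (hOpening k f) ⊆ Function.support f := fun q hq => by
  have := opening_le hk (fun j => f (q.1, j)) q.2
  rw [Function.mem_support, hOpening] at hq
  rw [Function.mem_support]
  simp only [Prod.mk.eta] at this
  omega

theorem support_vol_opening_subset {k : ℕ} (hk : 1 ≤ k) (f : ℤ × ℤ → ℕ) :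
    (Function.support fun i => vol (opening k fun j => f (i, j)))
      ⊆ Prod.fst '' Function.support f := fun i hi => by
  by_contra h
  refine hi (finsum_eq_zero_of_forall_eq_zero fun j => ?_)
  have hle := opening_le hk (fun j => f (i, j)) j
  have h0 : f (i, j) = 0 := by
    by_contra hne
    exact h ⟨(i, j), hne, rfl⟩
  omega

theorem vol2_hOpening {k : ℕ} (hk : 1 ≤ k) {f : ℤ × ℤ → ℕ} (hf : (Function.support f).Finite) :
    vol2 (hOpening k f) = ∑ᶠ i : ℤ, vol (opening k fun j => f (i, j)) :=
  finsum_curry _ (hf.subset (support_hOpening_subset hk f))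

theorem natCast_finsum_int {ι : Sort*} (g : ι → ℕ) :
    ((∑ᶠ i, g i : ℕ) : ℤ) = ∑ᶠ i, (g i : ℤ) :=
  (Nat.castAddMonoidHom ℤ).map_finsum_of_injective Nat.cast_injective g

/-- `V(Γₖ f) − V(Γ_{k+1} f) = Σ_i k · Σ_{h ≥ 1} n_{k,h}^{(i)}(f)` for the
horizontal (row-wise) openings of a two-dimensional DEM. -/
theorem vol2_hOpening_diff_eq (f : ℤ × ℤ → ℕ) (hf : (Function.support f).Finite)
    (k : ℕ) (hk : 1 ≤ k) :
    (vol2 (hOpening k f) : ℤ) - (vol2 (hOpening (k+1) f) : ℤ) =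
      ∑ᶠ i : ℤ, (k : ℤ) * ∑ᶠ h ∈ Set.Ici (1 : ℕ), (rowRunCount f i k h : ℤ) := by
  have hcast : ∀ i : ℤ, (k : ℤ) * ∑ᶠ h ∈ Set.Ici (1 : ℕ), (rowRunCount f i k h : ℤ) =
      (vol (opening k fun j => f (i, j)) : ℤ) - (vol (opening (k + 1) fun j => f (i, j)) : ℤ) := by
    intro i
    have hsum : ∑ᶠ h ∈ Set.Ici (1 : ℕ), (rowRunCount f i k h : ℤ)
        = ((∑ᶠ h ∈ Set.Ici (1 : ℕ), rowRunCount f i k h : ℕ) : ℤ) := by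
      simp_rw [natCast_finsum_int]
    rw [vol_opening_eq (finite_support_row hf i) hk, hsum]
    simp only [rowRunCount]
    push_cast
    ring
  have hfin : ∀ m : ℕ, 1 ≤ m →
      (Function.support fun i => (vol (opening m fun j => f (i, j)) : ℤ)).Finite := fun m hm =>
    ((hf.image Prod.fst).subset (support_vol_opening_subset hm f)).subset fun i hi => by
      simpa using hi
  simp_rw [hcast]
  rw [finsum_sub_distrib (hfin k hk) (hfin (k + 1) (by omega)), vol2_hOpening hk hf,
    vol2_hOpening (by omega) hf, natCast_finsum_int, natCast_finsum_int]

end Granulo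
end
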